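/- arXiv:2212.06428 — 5 statements merged into one kernel-verified Lean document; each statement's English description precedes it below -/
import Mathlib

section
/- Let n be a natural number, b > 0, ε > 0, and μ, μ' : Fin n → ℝ with ∑_j |μ_j − μ'_j| ≤ ε·b. Let Lap(μ, b) denote the measure on Fin n → ℝ given by the Lebesgue (pi-volume) measure with density t ↦ ∏_j (1/(2b)) · exp(−|t_j − μ_j|/b). Then for every measurable set S ⊆ (Fin n → ℝ), Lap(μ, b)(S) ≤ exp(ε) · Lap(μ', b)(S). -/
open scoped BigOperators
open MeasureTheory

/-- Event-probability form of the Laplace mechanism guarantee: if the centers `μ, μ'`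
satisfy `∑ j |μ j − μ' j| ≤ ε·b`, then the multivariate Laplace measures (densities
`t ↦ ∏ j (1/(2b))·exp(−|t j − μ j|/b)` with respect to the pi-volume measure) satisfy
`Lap(μ, b)(S) ≤ exp(ε) · Lap(μ', b)(S)` for every measurable `S`. -/
theorem laplace_mechanism_measure_ratio (n : ℕ) (b ε : ℝ) (hb : 0 < b) (hε : 0 < ε)
    (μ μ' : Fin n → ℝ) (hsens : ∑ j, |μ j - μ' j| ≤ ε * b)
    (S : Set (Fin n → ℝ)) (hS : MeasurableSet S) :
    volume.withDensity
        (fun t => ENNReal.ofReal (∏ j, 1 / (2 * b) * Real.exp (-|t j - μ j| / b))) S ≤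
      ENNReal.ofReal (Real.exp ε) *
        volume.withDensity
          (fun t => ENNReal.ofReal (∏ j, 1 / (2 * b) * Real.exp (-|t j - μ' j| / b))) S := by
  rw [withDensity_apply _ hS, withDensity_apply _ hS,
    ← lintegral_const_mul' _ _ ENNReal.ofReal_ne_top]
  refine lintegral_mono fun t => ?_
  rw [← ENNReal.ofReal_mul (Real.exp_pos ε).le]
  apply ENNReal.ofReal_le_ofReal
  rw [Finset.prod_mul_distrib, Finset.prod_mul_distrib, ← Real.exp_sum, ← Real.exp_sum,
    mul_left_comm, ← Real.exp_add]
  have hc : 0 ≤ ∏ _j : Fin n, 1 / (2 * b) := Finset.prod_nonneg fun _ _ => by positivity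
  refine mul_le_mul_of_nonneg_left (Real.exp_le_exp.mpr ?_) hc
  rw [← Finset.sum_div, ← Finset.sum_div, div_le_iff₀ hb, add_mul, div_mul_cancel₀ _ hb.ne']
  have h : ∑ j, -|t j - μ j| ≤ ∑ j, (|μ j - μ' j| + -|t j - μ' j|) := by
    refine Finset.sum_le_sum fun j _ => ?_
    have := abs_sub_le (t j) (μ j) (μ' j)
    linarith
  rw [Finset.sum_add_distrib] at h
  linarith
end

section
/- Let k, n be natural numbers, C > 0, and for each i : Fin k let ε_i > 0. Let μ, μ' : Fin k → (Fin n → ℝ) satisfy ∑_j |μ_i(j) − μ'_i(j)| ≤ 2C for every i. For each i let Lap(μ_i, 2C/ε_i) denote the measure on Fin n → ℝ with density t ↦ ∏_j (ε_i/(4C)) · exp(−ε_i·|t_j − μ_i(j)|/(2C)) with respect to the pi-volume measure, and let M(μ) be the product measure ⨂_i Lap(μ_i, 2C/ε_i) on Fin k → (Fin n → ℝ). Then for every measurable set S, M(μ)(S) ≤ exp(∑_i ε_i) · M(μ')(S). -/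
open scoped BigOperators
open MeasureTheory

theorem pi_le_aux {k : ℕ} {α : Fin k → Type*} [∀ i, MeasurableSpace (α i)]
    (ν ν' : ∀ i, Measure (α i)) (c : Fin k → ENNReal) (h : ∀ i s, ν i s ≤ c i * ν' i s)
    (h0 : ∏ i, c i ≠ 0) (ht : ∏ i, c i ≠ ⊤)
    (S : Set (∀ i, α i)) (hS : MeasurableSet S) :
    Measure.pi ν S ≤ (∏ i, c i) * Measure.pi ν' S := by
  rw [Measure.pi, Measure.pi, toMeasure_apply _ _ hS, toMeasure_apply _ _ hS]
  have key : (∏ i, c i)⁻¹ • OuterMeasure.pi (fun i => (ν i).toOuterMeasure) ≤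
      OuterMeasure.pi (fun i => (ν' i).toOuterMeasure) := by
    rw [OuterMeasure.le_pi]
    intro s _
    rw [OuterMeasure.smul_apply, smul_eq_mul, mul_comm, ← div_eq_mul_inv]
    apply ENNReal.div_le_of_le_mul'
    refine (OuterMeasure.pi_pi_le _ s).trans ?_
    rw [← Finset.prod_mul_distrib]
    exact Finset.prod_le_prod' fun i _ => h i (s i)
  have h2 := key S
  rw [OuterMeasure.smul_apply, smul_eq_mul, mul_comm, ← div_eq_mul_inv] at h2
  rwa [ENNReal.div_le_iff' h0 ht] at h2

/-- Measure-theoretic form of Theorem 2 (Collaborative-DP): the joint mechanism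
`M(μ) = ⨂ i, Lap(μ i, 2C/ε i)` over `k` filters whose outputs have ℓ¹-sensitivity at
most `2C` each satisfies `M(μ)(S) ≤ exp(∑ i, ε i) · M(μ')(S)` for every measurable `S`. -/
theorem collaborativeDP_measure_ratio (k n : ℕ) (C : ℝ) (hC : 0 < C)
    (ε : Fin k → ℝ) (hε : ∀ i, 0 < ε i)
    (μ μ' : Fin k → Fin n → ℝ)
    (hsens : ∀ i, ∑ j, |μ i j - μ' i j| ≤ 2 * C)
    (S : Set (Fin k → Fin n → ℝ)) (hS : MeasurableSet S) :
    Measure.pi (fun i => volume.withDensity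
        (fun t => ENNReal.ofReal
          (∏ j, ε i / (4 * C) * Real.exp (-(ε i * |t j - μ i j|) / (2 * C))))) S ≤
      ENNReal.ofReal (Real.exp (∑ i, ε i)) *
        Measure.pi (fun i => volume.withDensity
          (fun t => ENNReal.ofReal
            (∏ j, ε i / (4 * C) * Real.exp (-(ε i * |t j - μ' i j|) / (2 * C))))) S := by
  have hprod : ENNReal.ofReal (Real.exp (∑ i, ε i)) =
      ∏ i, ENNReal.ofReal (Real.exp (ε i)) := by
    rw [Real.exp_sum, ENNReal.ofReal_prod_of_nonneg fun i _ => (Real.exp_pos _).le]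
  have h0 : ENNReal.ofReal (Real.exp (∑ i, ε i)) ≠ 0 := by
    simpa using Real.exp_pos _
  have ht : ENNReal.ofReal (Real.exp (∑ i, ε i)) ≠ ⊤ := ENNReal.ofReal_ne_top
  rw [hprod] at h0 ht ⊢
  refine pi_le_aux _ _ _ (fun i s => ?_) h0 ht S hS
  rw [← smul_eq_mul (ENNReal.ofReal (Real.exp (ε i))), ← Measure.smul_apply, ← withDensity_smul' _ _ ENNReal.ofReal_ne_top]
  refine withDensity_mono (Filter.Eventually.of_forall fun t => ?_) s
  simp only [Pi.smul_apply, smul_eq_mul]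
  rw [← ENNReal.ofReal_mul (Real.exp_pos _).le]
  apply ENNReal.ofReal_le_ofReal
  have hi := hε i
  rw [Finset.prod_mul_distrib, Finset.prod_mul_distrib, ← Real.exp_sum, ← Real.exp_sum,
    mul_left_comm, ← Real.exp_add]
  refine mul_le_mul_of_nonneg_left (Real.exp_le_exp.2 ?_)
    (Finset.prod_nonneg fun j _ => by positivity)
  rw [← Finset.sum_div, ← Finset.sum_div, Finset.sum_neg_distrib, Finset.sum_neg_distrib,
    ← Finset.mul_sum, ← Finset.mul_sum, div_le_iff₀ (by positivity), add_mul,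
    div_mul_cancel₀ _ (by positivity)]
  have h3 : ∑ j, |t j - μ' i j| ≤ ∑ j, |t j - μ i j| + ∑ j, |μ i j - μ' i j| := by
    rw [← Finset.sum_add_distrib]
    exact Finset.sum_le_sum fun j _ => abs_sub_le _ _ _
  nlinarith [hsens i]
end

section
/- Let k, n be natural numbers, C > 0, ε_i > 0 for i : Fin k, and μ, μ' : Fin k → (Fin n → ℝ) with ∑_j |μ_i(j) − μ'_i(j)| ≤ 2C for every i. Let M(μ) = ⨂_i Lap(μ_i, 2C/ε_i) be the joint noisy-output measure, and let g be any measurable map from Fin k → (Fin n → ℝ) to a measurable space Y (the cloud's remaining inference network f^cloud). Then for every measurable set T ⊆ Y, the pushforward measures satisfy (g_* M(μ))(T) ≤ exp(∑_i ε_i) · (g_* M(μ'))(T). -/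
open scoped BigOperators
open MeasureTheory

/-- Domination of the factors passes to the product measure. -/
lemma pi_le_smul_pi {ι : Type*} [Fintype ι] {α : ι → Type*} [∀ i, MeasurableSpace (α i)]
    (ν ν' : ∀ i, Measure (α i)) (c : ι → ENNReal) (hc : ∀ i, c i ≠ ⊤)
    (h : ∀ i s, ν i s ≤ c i * ν' i s) (S : Set (∀ i, α i)) (hS : MeasurableSet S) :
    Measure.pi ν S ≤ (∏ i, c i) * Measure.pi ν' S := by
  have hc' : (∏ i, c i) ≠ ⊤ := ENNReal.prod_ne_top (fun i _ => hc i)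
  have key : OuterMeasure.pi (fun i => (ν i).toOuterMeasure) ≤
      (∏ i, c i) • OuterMeasure.pi (fun i => (ν' i).toOuterMeasure) := by
    unfold OuterMeasure.pi
    rw [OuterMeasure.smul_boundedBy hc']
    refine OuterMeasure.le_boundedBy.2 fun s => (OuterMeasure.boundedBy_le s).trans ?_
    simp only [piPremeasure, Pi.smul_apply, smul_eq_mul]
    rw [← Finset.prod_mul_distrib]
    exact Finset.prod_le_prod' fun i _ => h i _
  rw [Measure.pi_def, Measure.pi_def, toMeasure_apply _ _ hS, toMeasure_apply _ _ hS]
  exact key S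

/-- Pointwise comparison of two Laplace densities. -/
lemma laplace_density_le (n : ℕ) (C : ℝ) (hC : 0 < C) (e : ℝ) (he : 0 < e)
    (m m' t : Fin n → ℝ) (hs : ∑ j, |m j - m' j| ≤ 2 * C) :
    (∏ j, 1 / (2 * (2 * C / e)) * Real.exp (-|t j - m j| / (2 * C / e))) ≤
      Real.exp e * ∏ j, 1 / (2 * (2 * C / e)) * Real.exp (-|t j - m' j| / (2 * C / e)) := by
  have hb : 0 < 2 * C / e := by positivity
  have hbe : (2 * C) / (2 * C / e) = e := by field_simp
  generalize 2 * C / e = b at *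
  rw [Finset.prod_mul_distrib, Finset.prod_mul_distrib, ← Real.exp_sum, ← Real.exp_sum,
    mul_left_comm, ← Real.exp_add]
  refine mul_le_mul_of_nonneg_left (Real.exp_le_exp.2 ?_)
    (Finset.prod_nonneg fun _ _ => by positivity)
  rw [← Finset.sum_div, ← Finset.sum_div, ← hbe, ← add_div]
  refine div_le_div_of_nonneg_right ?_ hb.le
  have h1 : ∑ j, |t j - m' j| ≤ ∑ j, |t j - m j| + ∑ j, |m j - m' j| := by
    rw [← Finset.sum_add_distrib]
    exact Finset.sum_le_sum fun j _ => abs_sub_le _ _ _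
  simp only [Finset.sum_neg_distrib]
  linarith

/-- Theorem 2 combined with post-processing (Property 1): pushing the joint noisy-output
measure `M(μ) = ⨂ i, Lap(μ i, 2C/ε i)` forward along any measurable map `g` (the cloud's
remaining inference network) preserves the `exp(∑ i, ε i)` ratio bound on events. -/
theorem collaborativeDP_postprocessing {Y : Type*} [MeasurableSpace Y]
    (k n : ℕ) (C : ℝ) (hC : 0 < C)
    (ε : Fin k → ℝ) (hε : ∀ i, 0 < ε i)
    (μ μ' : Fin k → Fin n → ℝ)
    (hsens : ∀ i, ∑ j, |μ i j - μ' i j| ≤ 2 * C)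
    (g : (Fin k → Fin n → ℝ) → Y) (hg : Measurable g)
    (T : Set Y) (hT : MeasurableSet T) :
    (Measure.pi (fun i => volume.withDensity
        (fun t => ENNReal.ofReal
          (∏ j, 1 / (2 * (2 * C / ε i)) *
            Real.exp (-|t j - μ i j| / (2 * C / ε i)))))).map g T ≤
      ENNReal.ofReal (Real.exp (∑ i, ε i)) *
        (Measure.pi (fun i => volume.withDensity
          (fun t => ENNReal.ofReal
            (∏ j, 1 / (2 * (2 * C / ε i)) *
              Real.exp (-|t j - μ' i j| / (2 * C / ε i)))))).map g T := by
  rw [Measure.map_apply hg hT, Measure.map_apply hg hT, Real.exp_sum,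
    ENNReal.ofReal_prod_of_nonneg (fun i _ => (Real.exp_pos _).le)]
  refine pi_le_smul_pi _ _ _ (fun i => ENNReal.ofReal_ne_top) (fun i s => ?_) _ (hg hT)
  rw [← smul_eq_mul (ENNReal.ofReal (Real.exp (ε i))), ← Measure.smul_apply, ← withDensity_smul' _ _ ENNReal.ofReal_ne_top]
  refine withDensity_mono (Filter.Eventually.of_forall fun t => ?_) s
  simp only [Pi.smul_apply, smul_eq_mul]
  rw [← ENNReal.ofReal_mul (Real.exp_pos _).le]
  exact ENNReal.ofReal_le_ofReal
    (laplace_density_le n C hC (ε i) (hε i) (μ i) (μ' i) t (hsens i))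
end

section
/- Let ι be a finite index type, X a type of records, and for each element of a finite partition P of ι let a mechanism be given. Model a dataset as D : ι → X, and call D, D' adjacent if they differ at exactly one index. Suppose for each part p ∈ P a mechanism M_p : (p → X) → Measure Ω_p is given such that whenever two restricted datasets D|_p, D'|_p differ at at most one index, M_p(D|_p)(S) ≤ exp(ε_p) · M_p(D'|_p)(S) for all measurable S. Then the product mechanism D ↦ ⨂_{p ∈ P} M_p(D|_p) satisfies: for all adjacent D, D' (differing at exactly one index of ι) and every measurable set S of the product space, (⨂_p M_p(D|_p))(S) ≤ exp(max_p ε_p) · (⨂_p M_p(D'|_p))(S), assuming each M_p(D|_p) is a probability (or finite) measure. -/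
open MeasureTheory

/-- Product measures are monotone up to a factor on one coordinate. -/
theorem pi_le_smul_pi_aux {P : Type*} [Fintype P] {Ω : P → Type*} [∀ p, MeasurableSpace (Ω p)]
    (μ ν : ∀ p, Measure (Ω p)) [∀ p, IsProbabilityMeasure (μ p)]
    [∀ p, IsProbabilityMeasure (ν p)] (c : ENNReal) (hc0 : c ≠ 0) (hc : c ≠ ⊤) (p₀ : P)
    (h₀ : μ p₀ ≤ c • ν p₀) (h : ∀ p, p ≠ p₀ → μ p = ν p)
    (S : Set (∀ p, Ω p)) (hS : MeasurableSet S) :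
    Measure.pi μ S ≤ c * Measure.pi ν S := by
  classical
  have key : c⁻¹ • (Measure.pi μ).toOuterMeasure ≤
      OuterMeasure.pi (fun p => (ν p).toOuterMeasure) := by
    rw [OuterMeasure.le_pi]
    intro s _
    change c⁻¹ * Measure.pi μ (Set.pi Set.univ s) ≤ ∏ p, ν p (s p)
    rw [Measure.pi_pi, ENNReal.inv_mul_le_iff hc0 hc,
      ← Finset.mul_prod_erase _ _ (Finset.mem_univ p₀),
      ← Finset.mul_prod_erase _ (fun p => ν p (s p)) (Finset.mem_univ p₀), ← mul_assoc]
    refine mul_le_mul' (by simpa using h₀ (s p₀)) (le_of_eq ?_)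
    refine Finset.prod_congr rfl fun p hp => ?_
    rw [h p (Finset.ne_of_mem_erase hp)]
  have h1 := key S
  change c⁻¹ * Measure.pi μ S ≤ _ at h1
  rw [ENNReal.inv_mul_le_iff hc0 hc] at h1
  refine h1.trans (mul_le_mul' le_rfl ?_)
  rw [Measure.pi_def]
  exact le_toMeasure_apply _ _ _

/-- Parallel composition theorem of differential privacy (Theorem 1 of the paper).
Datasets are functions `D : ι → X` on a finite index type; a partition of `ι` is encoded
by a map `part : ι → P` onto a finite type of parts, a part `p` corresponding to the
fiber `{i // part i = p}`, and the restriction of `D` to the part `p` being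
`fun i : {i // part i = p} => D i`. If for every part `p` the mechanism
`M p : ({i // part i = p} → X) → Measure (Ω p)` satisfies the `exp (εp p)` event-ratio
bound on restricted datasets differing at at most one index, and each `M p d` is a
probability measure, then the product mechanism `D ↦ ⨂ p, M p (D|_p)` satisfies the
`exp (max_p εp p)` event-ratio bound on datasets differing at exactly one index. -/
theorem dp_parallel_composition {ι X P : Type*} [Fintype ι] [Fintype P] [Nonempty P]
    (part : ι → P)
    (Ω : P → Type*) [∀ p, MeasurableSpace (Ω p)]
    (M : ∀ p, ({i : ι // part i = p} → X) → Measure (Ω p))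
    [hfin : ∀ p d, IsProbabilityMeasure (M p d)]
    (εp : P → ℝ)
    (hM : ∀ p (D₁ D₂ : {i : ι // part i = p} → X),
      (∀ i i', D₁ i ≠ D₂ i → D₁ i' ≠ D₂ i' → i = i') →
      ∀ S : Set (Ω p), MeasurableSet S →
        M p D₁ S ≤ ENNReal.ofReal (Real.exp (εp p)) * M p D₂ S)
    (D D' : ι → X) (hadj : ∃! i, D i ≠ D' i)
    (S : Set (∀ p, Ω p)) (hS : MeasurableSet S) :
    Measure.pi (fun p => M p (fun i => D i.1)) S ≤
      ENNReal.ofReal (Real.exp (⨆ p, εp p)) *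
        Measure.pi (fun p => M p (fun i => D' i.1)) S := by
  obtain ⟨i₀, -, hi⟩ := hadj
  refine pi_le_smul_pi_aux _ _ _ (by simp [Real.exp_pos]) ENNReal.ofReal_ne_top (part i₀) ?_ ?_ S hS
  · rw [Measure.le_iff]
    intro T hT
    refine (hM (part i₀) _ (fun i => D' i.1) ?_ T hT).trans ?_
    · intro i i' h h'
      exact Subtype.ext ((hi _ h).trans (hi _ h').symm)
    · simp only [Measure.smul_apply, smul_eq_mul]
      gcongr
      exact le_ciSup (Set.finite_range εp).bddAbove _
  · intro p hp
    congr 1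
    funext i
    by_contra hne
    exact hp (by rw [← hi _ hne, i.2])
end

section
/- Let n be a natural number, ε > 0, Δ > 0, and μ, μ' : Fin n → ℝ with ∑_j |μ_j − μ'_j| ≤ Δ. Set b = Δ/ε, and let Lap(μ, b) be the multivariate Laplace probability measure centered at μ with scale b. Then the two-sided bound holds: for every measurable S ⊆ (Fin n → ℝ), exp(−ε) · Lap(μ', b)(S) ≤ Lap(μ, b)(S) ≤ exp(ε) · Lap(μ', b)(S). -/
open scoped BigOperators
open MeasureTheory

lemma laplace_density_le_s13 (n : ℕ) (ε Δ : ℝ) (hε : 0 < ε) (hΔ : 0 < Δ)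
    (μ μ' : Fin n → ℝ) (hsens : ∑ j, |μ j - μ' j| ≤ Δ) (t : Fin n → ℝ) :
    ∏ j, 1 / (2 * (Δ / ε)) * Real.exp (-|t j - μ j| / (Δ / ε)) ≤
      Real.exp ε * ∏ j, 1 / (2 * (Δ / ε)) * Real.exp (-|t j - μ' j| / (Δ / ε)) := by
  have hb : 0 < Δ / ε := div_pos hΔ hε
  rw [Finset.prod_mul_distrib, Finset.prod_mul_distrib, ← Real.exp_sum, ← Real.exp_sum,
    mul_left_comm, ← Real.exp_add]
  refine mul_le_mul_of_nonneg_left (Real.exp_le_exp.2 ?_)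
    (Finset.prod_nonneg fun _ _ => by positivity)
  rw [← Finset.sum_div, ← Finset.sum_div]
  have h1 : ∑ j, -|t j - μ j| ≤ ∑ j, |μ j - μ' j| + ∑ j, -|t j - μ' j| := by
    rw [← Finset.sum_add_distrib]
    refine Finset.sum_le_sum fun j _ => ?_
    have := abs_sub_le (t j) (μ j) (μ' j)
    linarith
  have h2 : ε = Δ / (Δ / ε) := by field_simp
  calc _ ≤ (Δ + ∑ j, -|t j - μ' j|) / (Δ / ε) := by gcongr; linarith
    _ = _ := by rw [add_div, ← h2]

lemma laplace_measure_le (n : ℕ) (ε Δ : ℝ) (hε : 0 < ε) (hΔ : 0 < Δ)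
    (μ μ' : Fin n → ℝ) (hsens : ∑ j, |μ j - μ' j| ≤ Δ)
    (S : Set (Fin n → ℝ)) (hS : MeasurableSet S) :
    volume.withDensity
        (fun t => ENNReal.ofReal
          (∏ j, 1 / (2 * (Δ / ε)) * Real.exp (-|t j - μ j| / (Δ / ε)))) S ≤
      ENNReal.ofReal (Real.exp ε) *
        volume.withDensity
          (fun t => ENNReal.ofReal
            (∏ j, 1 / (2 * (Δ / ε)) * Real.exp (-|t j - μ' j| / (Δ / ε)))) S := by
  rw [withDensity_apply _ hS, withDensity_apply _ hS,
    ← lintegral_const_mul' _ _ ENNReal.ofReal_ne_top]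
  refine lintegral_mono fun t => ?_
  rw [← ENNReal.ofReal_mul (Real.exp_pos _).le]
  exact ENNReal.ofReal_le_ofReal (laplace_density_le_s13 n ε Δ hε hΔ μ μ' hsens t)

/-- Two-sided form of the Laplace mechanism guarantee: if `∑ j, |μ j − μ' j| ≤ Δ` and
`b = Δ/ε`, then for every measurable `S`,
`exp(−ε) · Lap(μ', b)(S) ≤ Lap(μ, b)(S) ≤ exp(ε) · Lap(μ', b)(S)`, where `Lap(ν, b)` is
the pi-volume measure with density `t ↦ ∏ j, (1/(2b))·exp(−|t j − ν j|/b)`. -/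
theorem laplace_mechanism_two_sided (n : ℕ) (ε Δ : ℝ) (hε : 0 < ε) (hΔ : 0 < Δ)
    (μ μ' : Fin n → ℝ) (hsens : ∑ j, |μ j - μ' j| ≤ Δ)
    (S : Set (Fin n → ℝ)) (hS : MeasurableSet S) :
    ENNReal.ofReal (Real.exp (-ε)) *
        volume.withDensity
          (fun t => ENNReal.ofReal
            (∏ j, 1 / (2 * (Δ / ε)) * Real.exp (-|t j - μ' j| / (Δ / ε)))) S ≤
      volume.withDensity
        (fun t => ENNReal.ofReal
          (∏ j, 1 / (2 * (Δ / ε)) * Real.exp (-|t j - μ j| / (Δ / ε)))) S ∧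
    volume.withDensity
        (fun t => ENNReal.ofReal
          (∏ j, 1 / (2 * (Δ / ε)) * Real.exp (-|t j - μ j| / (Δ / ε)))) S ≤
      ENNReal.ofReal (Real.exp ε) *
        volume.withDensity
          (fun t => ENNReal.ofReal
            (∏ j, 1 / (2 * (Δ / ε)) * Real.exp (-|t j - μ' j| / (Δ / ε)))) S := by
  refine ⟨?_, laplace_measure_le n ε Δ hε hΔ μ μ' hsens S hS⟩
  have h := laplace_measure_le n ε Δ hε hΔ μ' μ
    (by simpa only [abs_sub_comm] using hsens) S hS
  refine (mul_le_mul_right h _).trans ?_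
  rw [← mul_assoc, ← ENNReal.ofReal_mul (Real.exp_pos _).le, ← Real.exp_add]
  simp
end
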